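/- Let T > 0, let V : ℝⁿ → ℝ be smooth, let Σ : ℝⁿ → ℝ^{n×n} be smooth with Σ(x) symmetric for every x, and let p : (0,T) × ℝⁿ → (0,∞) be smooth and satisfy the Fokker–Planck equation ∂_t p_t(x) = div( Σ(x) (∇ log p_t(x) + ∇V(x)) p_t(x) ) for all (t,x) ∈ (0,T) × ℝⁿ. With ℓ_t(x) := p_t(x) e^{V(x)}, the following pointwise entropy dissipation identity holds for all (t,x) ∈ (0,T) × ℝⁿ: ∂_t ( p_t(x) log ℓ_t(x) ) = div_x( e^{−V(x)} (1 + log ℓ_t(x)) Σ(x) ∇ℓ_t(x) ) − ⟨ ∇ log ℓ_t(x) , Σ(x) ∇ log ℓ_t(x) ⟩ p_t(x). -/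

import Mathlib

open MeasureTheory Matrix

/-- Gradient of a scalar field on `ℝⁿ` (components are partial derivatives). -/
noncomputable def vgrad {n : ℕ} (f : (Fin n → ℝ) → ℝ) (x : Fin n → ℝ) : Fin n → ℝ :=
  fun i => fderiv ℝ f x (Pi.single i 1)

/-- Divergence of a vector field on `ℝⁿ`. -/
noncomputable def vdiv {n : ℕ} (v : (Fin n → ℝ) → Fin n → ℝ) (x : Fin n → ℝ) : ℝ :=
  ∑ i, fderiv ℝ (fun y => v y i) x (Pi.single i 1)

/-- Leibniz rule for the divergence of a scalar multiple of a vector field. -/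
theorem vdiv_smul {n : ℕ} {φ : (Fin n → ℝ) → ℝ} {w : (Fin n → ℝ) → Fin n → ℝ} {x : Fin n → ℝ}
    (hφ : DifferentiableAt ℝ φ x) (hw : ∀ i, DifferentiableAt ℝ (fun y => w y i) x) :
    vdiv (fun y => φ y • w y) x = φ x * vdiv w x + vgrad φ x ⬝ᵥ w x := by
  simp only [vdiv, vgrad, dotProduct, Finset.mul_sum, ← Finset.sum_add_distrib, Pi.smul_apply,
    smul_eq_mul]
  refine Finset.sum_congr rfl fun i _ => ?_
  rw [fderiv_fun_mul hφ (hw i)]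
  simp [mul_comm]

theorem vgrad_add {n : ℕ} {f g : (Fin n → ℝ) → ℝ} {x : Fin n → ℝ}
    (hf : DifferentiableAt ℝ f x) (hg : DifferentiableAt ℝ g x) :
    vgrad (fun y => f y + g y) x = vgrad f x + vgrad g x := by
  ext i
  simp [vgrad, fderiv_fun_add hf hg]

theorem vgrad_const_add {n : ℕ} (c : ℝ) (f : (Fin n → ℝ) → ℝ) (x : Fin n → ℝ) :
    vgrad (fun y => c + f y) x = vgrad f x := by
  ext i
  simp [vgrad]

/-- The logarithmic derivative, multiplied by the function, is its gradient. -/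
theorem smul_vgrad_log {n : ℕ} {f : (Fin n → ℝ) → ℝ} {x : Fin n → ℝ}
    (hf : DifferentiableAt ℝ f x) (hx : f x ≠ 0) :
    f x • vgrad (fun y => Real.log (f y)) x = vgrad f x := by
  ext i
  simp [vgrad, fderiv.log hf hx, hx]

theorem ContDiff.differentiable_vgrad_apply {n : ℕ} {f : (Fin n → ℝ) → ℝ}
    (hf : ContDiff ℝ (⊤ : ℕ∞) f) (i : Fin n) : Differentiable ℝ (fun y => vgrad f y i) := by
  have h : ContDiff ℝ (⊤ : ℕ∞) (fderiv ℝ f) := hf.fderiv_right (by simp)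
  exact (h.differentiable (by simp)).clm_apply (differentiable_const _)

theorem differentiable_smul_mulVec_apply {n : ℕ} {f : (Fin n → ℝ) → ℝ}
    {A : (Fin n → ℝ) → Matrix (Fin n) (Fin n) ℝ} {w : (Fin n → ℝ) → Fin n → ℝ}
    (hf : Differentiable ℝ f) (hA : ∀ i j, Differentiable ℝ fun y => A y i j)
    (hw : ∀ i, Differentiable ℝ fun y => w y i) (i : Fin n) :
    Differentiable ℝ fun y => (f y • (A y *ᵥ w y)) i := by
  simp only [Pi.smul_apply, smul_eq_mul, mulVec, dotProduct]
  exact hf.mul (Differentiable.fun_sum fun j _ => (hA i j).mul (hw j))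

/-- Pointwise chain rule for `r ↦ r * log (c * r)` along a curve. -/
theorem deriv_mul_log_mul {g : ℝ → ℝ} {t c : ℝ} (hg : DifferentiableAt ℝ g t)
    (hgt : g t ≠ 0) (hc : c ≠ 0) :
    deriv (fun s => g s * Real.log (g s * c)) t = (1 + Real.log (g t * c)) * deriv g t := by
  have h := hg.hasDerivAt.mul ((hg.hasDerivAt.mul_const c).log (mul_ne_zero hgt hc))
  refine h.deriv.trans ?_
  field_simp
  ring

/-- pointwise entropy dissipation identity: with `ℓ_t = p_t e^V`,
`∂_t(p_t log ℓ_t) = div(e^{−V}(1 + log ℓ_t) Σ ∇ℓ_t) − ⟨∇ log ℓ_t, Σ ∇ log ℓ_t⟩ p_t`. -/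
theorem stmt_9 {n : ℕ} (T : ℝ) (hT : 0 < T)
    (V : (Fin n → ℝ) → ℝ) (hV : ContDiff ℝ (⊤ : ℕ∞) V)
    (Sm : (Fin n → ℝ) → Matrix (Fin n) (Fin n) ℝ)
    (hSm : ∀ i j, ContDiff ℝ (⊤ : ℕ∞) fun x => Sm x i j)
    (hSymm : ∀ x, (Sm x).IsSymm)
    (p : ℝ → (Fin n → ℝ) → ℝ)
    (hpsm : ContDiffOn ℝ (⊤ : ℕ∞) (fun q : ℝ × (Fin n → ℝ) => p q.1 q.2)
      (Set.Ioo 0 T ×ˢ Set.univ))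
    (hppos : ∀ t ∈ Set.Ioo (0:ℝ) T, ∀ x, 0 < p t x)
    (hFP : ∀ t ∈ Set.Ioo (0:ℝ) T, ∀ x : Fin n → ℝ,
      deriv (fun s => p s x) t
        = vdiv (fun y =>
            p t y • (Sm y *ᵥ (vgrad (fun z => Real.log (p t z)) y + vgrad V y))) x) :
    ∀ t ∈ Set.Ioo (0:ℝ) T, ∀ x : Fin n → ℝ,
      deriv (fun s => p s x * Real.log (p s x * Real.exp (V x))) t
        = vdiv (fun y =>
            (Real.exp (-V y) * (1 + Real.log (p t y * Real.exp (V y)))) •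
              (Sm y *ᵥ vgrad (fun z => p t z * Real.exp (V z)) y)) x
          - (vgrad (fun z => Real.log (p t z * Real.exp (V z))) x ⬝ᵥ
              (Sm x *ᵥ vgrad (fun z => Real.log (p t z * Real.exp (V z))) x)) * p t x := by
  intro t ht x
  have hnhds : ∀ y, Set.Ioo (0 : ℝ) T ×ˢ (Set.univ : Set (Fin n → ℝ)) ∈ nhds (t, y) := fun y =>
    (isOpen_Ioo.prod isOpen_univ).mem_nhds ⟨ht, Set.mem_univ y⟩
  have hp : ContDiff ℝ (⊤ : ℕ∞) (p t) := contDiff_iff_contDiffAt.2 fun y =>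
    (hpsm.contDiffAt (hnhds y)).comp y (contDiffAt_const.prodMk contDiffAt_id)
  have hpt : DifferentiableAt ℝ (fun s => p s x) t :=
    ((hpsm.contDiffAt (hnhds x)).differentiableAt (by simp)).comp t
      (f := fun s : ℝ => (s, x)) (differentiableAt_id.prodMk (differentiableAt_const x))
  have hp0 : ∀ y, p t y ≠ 0 := fun y => (hppos t ht y).ne'
  have hℓ : ContDiff ℝ (⊤ : ℕ∞) fun z => p t z * Real.exp (V z) := hp.mul hV.exp
  have hℓ0 : ∀ y, p t y * Real.exp (V y) ≠ 0 := fun y => mul_ne_zero (hp0 y) (Real.exp_ne_zero _)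
  have hL : ContDiff ℝ (⊤ : ℕ∞) fun z => Real.log (p t z * Real.exp (V z)) := hℓ.log hℓ0
  have hLd := hL.differentiable (by simp)
  have hgradL : ∀ y, vgrad (fun z => Real.log (p t z)) y + vgrad V y
      = vgrad (fun z => Real.log (p t z * Real.exp (V z))) y := fun y => by
    rw [← vgrad_add ((hp.log hp0).differentiable (by simp) y) (hV.differentiable (by simp) y)]
    congr 1
    ext z
    rw [Real.log_mul (hp0 z) (Real.exp_ne_zero _), Real.log_exp]
  have hflux : (fun y => (Real.exp (-V y) * (1 + Real.log (p t y * Real.exp (V y)))) •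
        (Sm y *ᵥ vgrad (fun z => p t z * Real.exp (V z)) y))
      = fun y => (1 + Real.log (p t y * Real.exp (V y))) •
        (p t y • (Sm y *ᵥ vgrad (fun z => Real.log (p t z * Real.exp (V z))) y)) := by
    funext y
    rw [← smul_vgrad_log (hℓ.differentiable (by simp) y) (hℓ0 y), mulVec_smul, smul_smul,
      smul_smul]
    congr 1
    rw [Real.exp_neg]
    field_simp
  have hFPx := hFP t ht x
  simp only [hgradL] at hFPx
  rw [deriv_mul_log_mul hpt (hp0 x) (Real.exp_ne_zero _), hflux, hFPx,
    vdiv_smul ((hLd x).const_add 1) fun i => differentiable_smul_mulVec_apply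
      (hp.differentiable (by simp)) (fun i j => (hSm i j).differentiable (by simp))
      hL.differentiable_vgrad_apply i x,
    vgrad_const_add, dotProduct_smul, smul_eq_mul]
  ring
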